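/- For every integer n ≥ 2, the propeller graph P²_n satisfies λ(P²_n) = n + 2, ν(P²_n) = n, μ(P²_n) = n, and hence μ'(P²_n) = 2. In particular, the difference μ(G) − μ'(G) can be arbitrarily large over finite connected graphs G. -/

import Mathlib

open Finset

section Defs
variable {V : Type*}

/-- A matching: a set of edges, pairwise non-adjacent. -/
def IsMatchingSet (G : SimpleGraph V) (M : Finset (Sym2 V)) : Prop :=
  ↑M ⊆ G.edgeSet ∧ ∀ e ∈ M, ∀ f ∈ M, e ≠ f → ∀ v : V, v ∈ e → v ∉ f

/-- A vertex is saturated by a matching if some edge of it is incident to the vertex. -/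
def Saturates (M : Finset (Sym2 V)) (v : V) : Prop :=
  ∃ e ∈ M, v ∈ e

/-- ν(G): maximum size of a matching. -/
noncomputable def nuG (G : SimpleGraph V) : ℕ :=
  sSup {n | ∃ M : Finset (Sym2 V), IsMatchingSet G M ∧ M.card = n}

/-- λ(G): maximum of |H| + |H'| over pairs of disjoint matchings. -/
noncomputable def lamG (G : SimpleGraph V) : ℕ :=
  sSup {n | ∃ H H' : Finset (Sym2 V), IsMatchingSet G H ∧ IsMatchingSet G H' ∧
    Disjoint H H' ∧ H.card + H'.card = n}

/-- Λ(G): set of pairs of disjoint matchings realizing λ(G). -/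
def LambdaSet (G : SimpleGraph V) : Set (Finset (Sym2 V) × Finset (Sym2 V)) :=
  {p | IsMatchingSet G p.1 ∧ IsMatchingSet G p.2 ∧ Disjoint p.1 p.2 ∧
    p.1.card + p.2.card = lamG G}

/-- μ(G): maximum of |H| over pairs (H, H') ∈ Λ(G). -/
noncomputable def muG (G : SimpleGraph V) : ℕ :=
  sSup {n | ∃ p ∈ LambdaSet G, p.1.card = n}

/-- Λ_μ(G): pairs in Λ(G) with |H| = μ(G). -/
def LambdaMuSet (G : SimpleGraph V) : Set (Finset (Sym2 V) × Finset (Sym2 V)) :=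
  {p | p ∈ LambdaSet G ∧ p.1.card = muG G}

end Defs

/-- The propeller graph P²ₙ: a central vertex `none` joined to n paths of length 2;
blade i consists of vᵢ = some (i, 0) and wᵢ = some (i, 1), with edges u vᵢ and vᵢ wᵢ. -/
def propeller (n : ℕ) : SimpleGraph (Option (Fin n × Fin 2)) :=
  SimpleGraph.fromRel (fun a b =>
    (∃ i : Fin n, a = none ∧ b = some (i, 0)) ∨
    (∃ i : Fin n, a = some (i, 0) ∧ b = some (i, 1)))

/-- The edge of the propeller joining the center to blade `i`. -/
def innerEdge {n : ℕ} (i : Fin n) : Sym2 (Option (Fin n × Fin 2)) :=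
  s(none, some (i, 0))

/-- The edge of blade `i` away from the center. -/
def outerEdge {n : ℕ} (i : Fin n) : Sym2 (Option (Fin n × Fin 2)) :=
  s(some (i, 0), some (i, 1))

theorem mem_edgeSet_propeller {n : ℕ} {e : Sym2 (Option (Fin n × Fin 2))} :
    e ∈ (propeller n).edgeSet ↔ ∃ i, e = innerEdge i ∨ e = outerEdge i := by
  induction e using Sym2.ind with
  | _ a b =>
    simp only [SimpleGraph.mem_edgeSet, propeller, SimpleGraph.fromRel_adj, innerEdge, outerEdge,
      Sym2.eq_iff]
    constructor
    · rintro ⟨-, (⟨i, h⟩ | ⟨i, h⟩) | (⟨i, h⟩ | ⟨i, h⟩)⟩ <;> exact ⟨i, by tauto⟩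
    · rintro ⟨i, (⟨rfl, rfl⟩ | ⟨rfl, rfl⟩) | (⟨rfl, rfl⟩ | ⟨rfl, rfl⟩)⟩ <;> simp

/-- Two edges of a matching sharing a vertex coincide. -/
theorem IsMatchingSet.eq_of_mem {V : Type*} {G : SimpleGraph V} {M : Finset (Sym2 V)}
    (hM : IsMatchingSet G M) {e f : Sym2 V} (he : e ∈ M) (hf : f ∈ M) {v : V}
    (hve : v ∈ e) (hvf : v ∈ f) : e = f := by
  by_contra hne
  exact hM.2 e he f hf hne v hve hvf

theorem IsMatchingSet.card_le_propeller {n : ℕ} {M : Finset (Sym2 (Option (Fin n × Fin 2)))}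
    (hM : IsMatchingSet (propeller n) M) : M.card ≤ n := by
  have blade (e : M) : ∃ i : Fin n, some (i, 0) ∈ e.1 := by
    obtain ⟨i, h | h⟩ := mem_edgeSet_propeller.1 (hM.1 e.2) <;>
      exact ⟨i, by simp [h, innerEdge, outerEdge]⟩
  choose f hf using blade
  have hinj : Function.Injective f := fun a b hab =>
    Subtype.ext (hM.eq_of_mem a.2 b.2 (hf a) (hab ▸ hf b))
  simpa using Fintype.card_le_of_injective f hinj

open Classical in
theorem card_add_card_le_propeller {n : ℕ} {H H' : Finset (Sym2 (Option (Fin n × Fin 2)))}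
    (hH : IsMatchingSet (propeller n) H) (hH' : IsMatchingSet (propeller n) H')
    (hd : Disjoint H H') : H.card + H'.card ≤ n + 2 := by
  have central {M : Finset (Sym2 (Option (Fin n × Fin 2)))}
      (hM : IsMatchingSet (propeller n) M) : (M.filter (none ∈ ·)).card ≤ 1 := by
    refine Finset.card_le_one.2 fun a ha b hb => ?_
    rw [Finset.mem_filter] at ha hb
    exact hM.eq_of_mem ha.1 hb.1 ha.2 hb.2
  have cover {M : Finset (Sym2 (Option (Fin n × Fin 2)))}
      (hM : IsMatchingSet (propeller n) M) :
      M ⊆ univ.image outerEdge ∪ M.filter (none ∈ ·) := by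
    intro e he
    obtain ⟨i, rfl | rfl⟩ := mem_edgeSet_propeller.1 (hM.1 he)
    · exact mem_union_right _ (mem_filter.2 ⟨he, by simp [innerEdge]⟩)
    · exact mem_union_left _ (mem_image_of_mem _ (mem_univ i))
  have hsub : H ∪ H' ⊆
      univ.image outerEdge ∪ (H.filter (none ∈ ·) ∪ H'.filter (none ∈ ·)) := by
    have h := cover hH
    have h' := cover hH'
    intro e he
    have := @h e
    have := @h' e
    simp only [mem_union] at *
    tauto
  have h1 := card_le_card hsub
  rw [card_union_of_disjoint hd] at h1
  have h2 := card_union_le (univ.image (outerEdge (n := n)))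
    (H.filter (none ∈ ·) ∪ H'.filter (none ∈ ·))
  have h3 := card_union_le (H.filter (none ∈ ·)) (H'.filter (none ∈ ·))
  have h4 : (univ.image (outerEdge (n := n))).card ≤ n := by
    simpa using card_image_le (s := univ) (f := outerEdge (n := n))
  have h5 := central hH
  have h6 := central hH'
  omega

open Classical in
/-- For distinct blades, the propeller has disjoint matchings of sizes `n` and `2`. -/
theorem exists_disjoint_matchings_propeller {n : ℕ} {i j : Fin n} (hij : i ≠ j) :
    ∃ H H' : Finset (Sym2 (Option (Fin n × Fin 2))),
      IsMatchingSet (propeller n) H ∧ IsMatchingSet (propeller n) H' ∧ Disjoint H H' ∧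
      H.card = n ∧ H'.card = 2 := by
  refine ⟨univ.image fun k => if k = i then innerEdge k else outerEdge k,
    {innerEdge j, outerEdge i}, ⟨?_, ?_⟩, ⟨?_, ?_⟩, ?_, ?_, ?_⟩
  · intro e he
    simp only [coe_image, coe_univ, Set.image_univ, Set.mem_range] at he
    obtain ⟨k, rfl⟩ := he
    exact mem_edgeSet_propeller.2 ⟨k, by split_ifs <;> simp⟩
  · simp only [mem_image, mem_univ, true_and]
    rintro _ ⟨k, rfl⟩ _ ⟨l, rfl⟩ hne v hv hv'
    have hkl : k ≠ l := fun h => hne (h ▸ rfl)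
    split_ifs at hv hv' <;> simp only [innerEdge, outerEdge, Sym2.mem_iff] at hv hv' <;>
      rcases hv with rfl | rfl <;> simp_all
  · intro e he
    simp only [coe_insert, coe_singleton, Set.mem_insert_iff, Set.mem_singleton_iff] at he
    rcases he with rfl | rfl
    · exact mem_edgeSet_propeller.2 ⟨j, by simp⟩
    · exact mem_edgeSet_propeller.2 ⟨i, by simp⟩
  · simp only [mem_insert, mem_singleton]
    rintro _ (rfl | rfl) _ (rfl | rfl) hne v hv hv' <;>
      simp only [innerEdge, outerEdge, Sym2.mem_iff] at hv hv' <;>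
      rcases hv with rfl | rfl <;> simp_all
  · rw [Finset.disjoint_left]
    simp only [mem_image, mem_univ, true_and, mem_insert, mem_singleton]
    rintro _ ⟨k, rfl⟩ h
    split_ifs at h <;> simp [innerEdge, outerEdge] at h <;> simp_all
  · rw [card_image_of_injective, card_univ, Fintype.card_fin]
    intro k l h
    dsimp only at h
    split_ifs at h <;> simp [innerEdge, outerEdge] at h <;> simp_all
  · exact card_pair (by simp [innerEdge, outerEdge])

theorem lamG_propeller {n : ℕ} (hn : 2 ≤ n) : lamG (propeller n) = n + 2 := by
  refine IsGreatest.csSup_eq ⟨?_, ?_⟩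
  · obtain ⟨H, H', h, h', hd, hc, hc'⟩ := exists_disjoint_matchings_propeller
      (i := (⟨0, by omega⟩ : Fin n)) (j := ⟨1, by omega⟩) (by simp)
    exact ⟨H, H', h, h', hd, by rw [hc, hc']⟩
  · rintro _ ⟨H, H', h, h', hd, rfl⟩
    exact card_add_card_le_propeller h h' hd

theorem nuG_propeller {n : ℕ} (hn : 2 ≤ n) : nuG (propeller n) = n := by
  refine IsGreatest.csSup_eq ⟨?_, ?_⟩
  · obtain ⟨H, -, h, -, -, hc, -⟩ := exists_disjoint_matchings_propeller
      (i := (⟨0, by omega⟩ : Fin n)) (j := ⟨1, by omega⟩) (by simp)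
    exact ⟨H, h, hc⟩
  · rintro _ ⟨M, hM, rfl⟩
    exact hM.card_le_propeller

theorem muG_propeller {n : ℕ} (hn : 2 ≤ n) : muG (propeller n) = n := by
  refine IsGreatest.csSup_eq ⟨?_, ?_⟩
  · obtain ⟨H, H', h, h', hd, hc, hc'⟩ := exists_disjoint_matchings_propeller
      (i := (⟨0, by omega⟩ : Fin n)) (j := ⟨1, by omega⟩) (by simp)
    exact ⟨(H, H'), ⟨h, h', hd, by rw [lamG_propeller hn, hc, hc']⟩, hc⟩
  · rintro _ ⟨p, hp, rfl⟩
    exact hp.1.card_le_propeller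

theorem propeller_connected (n : ℕ) : (propeller n).Connected := by
  rw [SimpleGraph.connected_iff_exists_forall_reachable]
  have inner (i : Fin n) : (propeller n).Adj none (some (i, 0)) :=
    mem_edgeSet_propeller.2 ⟨i, .inl rfl⟩
  have outer (i : Fin n) : (propeller n).Adj (some (i, 0)) (some (i, 1)) :=
    mem_edgeSet_propeller.2 ⟨i, .inr rfl⟩
  refine ⟨none, ?_⟩
  rintro (_ | ⟨i, k⟩)
  · exact .rfl
  · fin_cases k
    · exact (inner i).reachable
    · exact (inner i).reachable.trans (outer i).reachable

/-- For every n ≥ 2, λ(P²ₙ) = n + 2, ν(P²ₙ) = n, μ(P²ₙ) = n, hence μ'(P²ₙ) = 2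
(where μ' = λ - μ); in particular the difference μ(G) - μ'(G) is arbitrarily large
over finite connected graphs. -/
theorem stmt11 :
    (∀ n : ℕ, 2 ≤ n →
      lamG (propeller n) = n + 2 ∧ nuG (propeller n) = n ∧ muG (propeller n) = n ∧
      lamG (propeller n) - muG (propeller n) = 2) ∧
    (∀ N : ℕ, ∃ (V : Type) (_ : Fintype V) (G : SimpleGraph V),
      G.Connected ∧ N ≤ muG G - (lamG G - muG G)) := by
  refine ⟨fun n hn => ⟨lamG_propeller hn, nuG_propeller hn, muG_propeller hn, ?_⟩, fun N =>
    ⟨_, inferInstance, propeller (N + 2), propeller_connected _, ?_⟩⟩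
  · rw [lamG_propeller hn, muG_propeller hn]
    omega
  · rw [lamG_propeller (by omega), muG_propeller (by omega)]
    omega
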